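/- Let p, q > 0 and ν > 0, and consider the translation surface r(u,v) = (u, v, −(ν/2)·ln(sinh(pu)^(1/p²)·cos(qv)^(1/q²))), i.e., f(u) = −(ν/(2p²))ln(sinh(pu)) for u > 0 and g(v) = −(ν/(2q²))ln(cos(qv)) on an interval where cos(qv) > 0, so that α(u) = −(ν/(2p))coth(pu) and β(v) = (ν/(2q))tan(qv). Then α'(u) ≠ 0 and β'(v) ≠ 0 everywhere on the domain, and num(u,v) = 4α'(u)β'(v)·((1+β(v)²)α'(u) + (1+α(u)²)β'(v)); i.e., this surface satisfies K_II = 2H. -/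

import Mathlib

/-- The numerator of the second Gaussian curvature `K_II` of the translation
surface `r(u,v) = (u, v, f(u) + g(v))`, where `α = f'` and `β = g'`. -/
noncomputable def num (α β : ℝ → ℝ) (u v : ℝ) : ℝ :=
  -2 * α u ^ 2 * deriv α u ^ 2 * deriv β v
  - 2 * deriv α u * β v ^ 2 * deriv β v ^ 2
  + 2 * α u ^ 2 * deriv α u * deriv β v ^ 2
  + 2 * deriv α u ^ 2 * β v ^ 2 * deriv β v
  + 2 * deriv α u * deriv β v ^ 2
  + 2 * deriv α u ^ 2 * deriv β v
  + deriv α u * β v * deriv (deriv β) v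
  + α u * deriv (deriv α) u * deriv β v
  + α u ^ 2 * deriv α u * β v * deriv (deriv β) v
  + α u * deriv (deriv α) u * β v ^ 2 * deriv β v
  + deriv α u * β v ^ 3 * deriv (deriv β) v
  + α u ^ 3 * deriv (deriv α) u * deriv β v

/-- The slope `-(ν/(2p)) coth(px)` satisfies a Riccati equation. -/
theorem hasDerivAt_neg_coth {p ν : ℝ} (hp : 0 < p) (hν : 0 < ν) {u : ℝ} (hu : 0 < u) :
    HasDerivAt (fun x : ℝ => -(ν / (2 * p)) * (Real.cosh (p * x) / Real.sinh (p * x)))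
      (2 * p ^ 2 / ν * (-(ν / (2 * p)) * (Real.cosh (p * u) / Real.sinh (p * u))) ^ 2 - ν / 2)
      u := by
  have hs : Real.sinh (p * u) ≠ 0 := (Real.sinh_pos_iff.2 (mul_pos hp hu)).ne'
  have hl : HasDerivAt (fun x : ℝ => p * x) p u := by
    simpa using (hasDerivAt_id u).const_mul p
  refine ((hl.cosh.div hl.sinh hs).const_mul (-(ν / (2 * p)))).congr_deriv ?_
  field_simp
  rw [Real.cosh_sq]
  ring

/-- The slope `(ν/(2q)) tan(qx)` satisfies a Riccati equation. -/
theorem hasDerivAt_const_mul_tan {q ν : ℝ} (hq : 0 < q) (hν : 0 < ν) {v : ℝ}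
    (hv : 0 < Real.cos (q * v)) :
    HasDerivAt (fun x : ℝ => (ν / (2 * q)) * Real.tan (q * x))
      (2 * q ^ 2 / ν * ((ν / (2 * q)) * Real.tan (q * v)) ^ 2 + ν / 2) v := by
  have hl : HasDerivAt (fun x : ℝ => q * x) q v := by
    simpa using (hasDerivAt_id v).const_mul q
  refine (((Real.hasDerivAt_tan hv.ne').comp v hl).const_mul (ν / (2 * q))).congr_deriv ?_
  rw [one_div, ← Real.inv_one_add_tan_sq hv.ne', inv_inv]
  field_simp
  ring

/-- A function with `f' = c f² + d` near `x` has `f'' = 2 c f f'` at `x`. -/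
theorem deriv_deriv_of_riccati {f : ℝ → ℝ} {c d x : ℝ}
    (h : ∀ᶠ y in nhds x, HasDerivAt f (c * f y ^ 2 + d) y) :
    deriv (deriv f) x = 2 * c * f x * deriv f x := by
  have hd : deriv f =ᶠ[nhds x] fun y => c * f y ^ 2 + d := h.mono fun y hy => hy.deriv
  have hx := h.self_of_nhds
  rw [hd.deriv_eq, hx.deriv]
  refine (((hx.pow 2).const_mul c).add_const d).deriv.trans ?_
  push_cast
  ring

/-- The identity `K_II = 2H` for a translation surface whose profile curves have slopes
satisfying Riccati equations with opposite constant terms. -/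
theorem num_eq_of_riccati {α β : ℝ → ℝ} {a b c u v : ℝ}
    (hα : ∀ᶠ x in nhds u, HasDerivAt α (a * α x ^ 2 - c) x)
    (hβ : ∀ᶠ x in nhds v, HasDerivAt β (b * β x ^ 2 + c) x) :
    num α β u v = 4 * deriv α u * deriv β v *
      ((1 + β v ^ 2) * deriv α u + (1 + α u ^ 2) * deriv β v) := by
  unfold num
  rw [deriv_deriv_of_riccati (f := α) (x := u) (c := a) (d := -c) (by simpa only [sub_eq_add_neg] using hα),
    deriv_deriv_of_riccati hβ, hα.self_of_nhds.deriv, hβ.self_of_nhds.deriv]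
  ring

/-- The translation surface `r(u,v) = (u, v, -(ν/2)ln(sinh(pu)^(1/p²)cos(qv)^(1/q²)))`,
i.e. `α(u) = -(ν/(2p))coth(pu)` for `u > 0` and `β(v) = (ν/(2q))tan(qv)` where
`cos(qv) > 0`, has nowhere vanishing `α'`, `β'` and satisfies `K_II = 2H`. -/
theorem stmt_9 (p q ν : ℝ) (hp : 0 < p) (hq : 0 < q) (hν : 0 < ν)
    (J : Set ℝ) (hJ : ∀ v ∈ J, 0 < Real.cos (q * v)) :
    ∀ u : ℝ, 0 < u → ∀ v ∈ J,
      deriv (fun x : ℝ => -(ν / (2 * p)) * (Real.cosh (p * x) / Real.sinh (p * x))) u ≠ 0 ∧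
      deriv (fun x : ℝ => (ν / (2 * q)) * Real.tan (q * x)) v ≠ 0 ∧
      num (fun x : ℝ => -(ν / (2 * p)) * (Real.cosh (p * x) / Real.sinh (p * x)))
          (fun x : ℝ => (ν / (2 * q)) * Real.tan (q * x)) u v =
        4 * deriv (fun x : ℝ => -(ν / (2 * p)) * (Real.cosh (p * x) / Real.sinh (p * x))) u *
          deriv (fun x : ℝ => (ν / (2 * q)) * Real.tan (q * x)) v *
          ((1 + ((ν / (2 * q)) * Real.tan (q * v)) ^ 2) *
              deriv (fun x : ℝ => -(ν / (2 * p)) * (Real.cosh (p * x) / Real.sinh (p * x))) u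
            + (1 + (-(ν / (2 * p)) * (Real.cosh (p * u) / Real.sinh (p * u))) ^ 2) *
              deriv (fun x : ℝ => (ν / (2 * q)) * Real.tan (q * x)) v) := by
  intro u hu v hv
  have hc := hJ v hv
  refine ⟨?_, ?_, num_eq_of_riccati (a := 2 * p ^ 2 / ν) (b := 2 * q ^ 2 / ν) (c := ν / 2) ?_ ?_⟩
  · rw [(hasDerivAt_neg_coth hp hν hu).deriv]
    have hs : 0 < Real.sinh (p * u) := Real.sinh_pos_iff.2 (mul_pos hp hu)
    have h : 2 * p ^ 2 / ν * (-(ν / (2 * p)) * (Real.cosh (p * u) / Real.sinh (p * u))) ^ 2 - ν / 2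
        = ν / (2 * Real.sinh (p * u) ^ 2) := by
      field_simp
      rw [Real.cosh_sq]
      ring
    rw [h]
    positivity
  · rw [(hasDerivAt_const_mul_tan hq hν hc).deriv]
    positivity
  · filter_upwards [lt_mem_nhds hu] with x hx using hasDerivAt_neg_coth hp hν hx
  · have hcont : Continuous fun x : ℝ => Real.cos (q * x) := by fun_prop
    filter_upwards [hcont.continuousAt.eventually (lt_mem_nhds hc)] with x hx
      using hasDerivAt_const_mul_tan hq hν hx
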